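/- For every pair of nonnegative integers k and N there is a constant C > 0 such that for all ν ≥ 2, the function ν ↦ ∫_0^1 1/(u·M²(ν,u)) du is k times differentiable and |(d/dν)^k ∫_0^1 1/(u·M²(ν,u)) du| ≤ C·ν^{−N}. In particular, ∫_0^1 1/(u·M²(ν,u)) du together with all its ν-derivatives decays faster than any power of ν^{−1} as ν → ∞. -/

import Mathlib

open Real MeasureTheory Set Filter intervalIntegral

/-- Integral representation of the modified Bessel function `K₀`. -/
noncomputable def K0 (x : ℝ) : ℝ := ∫ t in Ioi (0:ℝ), Real.exp (-x * Real.cosh t)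

/-- Bessel modulus squared, via Nicholson's formula. -/
noncomputable def M2 (ν z : ℝ) : ℝ :=
  (8 / π ^ 2) * ∫ t in Ioi (0:ℝ), K0 (2 * z * Real.sinh t) * Real.cosh (2 * ν * t)

open scoped Topology

section DerivativeChain

variable {G : ℕ → ℝ → ℝ} {s : Set ℝ}

lemma iteratedDeriv_eq_of_forall_hasDerivAt (hs : IsOpen s)
    (h : ∀ k, ∀ x ∈ s, HasDerivAt (G k) (G (k + 1) x) x) (k : ℕ) :
    ∀ x ∈ s, iteratedDeriv k (G 0) x = G k x := by
  induction k with
  | zero => simp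
  | succ k ih =>
    intro x hx
    have heq : iteratedDeriv k (G 0) =ᶠ[𝓝 x] G k := by
      filter_upwards [hs.mem_nhds hx] with y hy using ih y hy
    rw [iteratedDeriv_succ, heq.deriv_eq, (h k x hx).deriv]

lemma contDiffOn_of_forall_hasDerivAt (hs : IsOpen s)
    (h : ∀ k, ∀ x ∈ s, HasDerivAt (G k) (G (k + 1) x) x) (n : ℕ) :
    ∀ k, ContDiffOn ℝ n (G k) s := by
  induction n with
  | zero =>
    intro k
    rw [Nat.cast_zero, contDiffOn_zero]
    exact fun x hx => (h k x hx).continuousAt.continuousWithinAt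
  | succ n ih =>
    intro k
    push_cast
    rw [contDiffOn_succ_iff_deriv_of_isOpen hs]
    refine ⟨fun x hx => (h k x hx).differentiableAt.differentiableWithinAt, by simp, ?_⟩
    exact (ih (k + 1)).congr fun x hx => (h k x hx).deriv

lemma contDiffAt_of_forall_hasDerivAt (hs : IsOpen s)
    (h : ∀ k, ∀ x ∈ s, HasDerivAt (G k) (G (k + 1) x) x) (n : ℕ) {x : ℝ} (hx : x ∈ s) :
    ContDiffAt ℝ n (G 0) x :=
  (contDiffOn_of_forall_hasDerivAt hs h n 0).contDiffAt (hs.mem_nhds hx)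

lemma hasDerivAt_iteratedDeriv {f : ℝ → ℝ} {x : ℝ} {k : ℕ} (h : ContDiffAt ℝ (k + 1 : ℕ) f x) :
    HasDerivAt (iteratedDeriv k f) (iteratedDeriv (k + 1) f x) x := by
  rw [iteratedDeriv_succ]
  refine DifferentiableAt.hasDerivAt ?_
  induction k generalizing f with
  | zero => simpa using h.differentiableAt (by simp)
  | succ k ih =>
    rw [iteratedDeriv_succ']
    exact ih (h.derivWithin (by norm_cast))

/-- Repeated differentiation under the integral sign: the chain of integrals of `g k` is a
derivative chain as soon as `g k` is one pointwise and is locally dominated. -/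
lemma hasDerivAt_integral_of_forall_hasDerivAt {α : Type*} [MeasurableSpace α] {μ : Measure α}
    {g : ℕ → ℝ → α → ℝ} (hs : IsOpen s)
    (hmeas : ∀ x ∈ s, AEStronglyMeasurable (g 0 x) μ)
    (hderiv : ∀ k, ∀ᵐ a ∂μ, ∀ x ∈ s, HasDerivAt (fun y => g k y a) (g (k + 1) x a) x)
    (hbound : ∀ k, ∀ x ∈ s, ∃ t ∈ 𝓝 x, ∃ b : α → ℝ, Integrable b μ ∧
      ∀ᵐ a ∂μ, ∀ y ∈ t, ‖g k y a‖ ≤ b a) (k : ℕ) :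
    ∀ x ∈ s, HasDerivAt (fun y => ∫ a, g k y a ∂μ) (∫ a, g (k + 1) x a ∂μ) x := by
  have hm : ∀ k, ∀ x ∈ s, AEStronglyMeasurable (g k x) μ := by
    intro k
    induction k with
    | zero => exact hmeas
    | succ k ih =>
      intro x hx
      obtain ⟨v, hv⟩ : ∃ v : ℕ → ℝ, Tendsto v atTop (𝓝[≠] 0) ∧ ∀ n, x + v n ∈ s := by
        have hfreq : ∃ᶠ y in 𝓝[≠] (0 : ℝ), x + y ∈ s := by
          refine Eventually.frequently ?_
          have : Tendsto (fun y => x + y) (𝓝 0) (𝓝 x) := by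
            simpa only [add_zero] using
              (show Continuous fun y : ℝ => x + y by fun_prop).tendsto 0
          exact nhdsWithin_le_nhds (this (hs.mem_nhds hx))
        exact exists_seq_forall_of_frequently hfreq
      refine aestronglyMeasurable_of_tendsto_ae atTop
        (f := fun n a => (v n)⁻¹ • (g k (x + v n) a - g k x a)) ?_ ?_
      · exact fun n => ((ih _ (hv.2 n)).sub (ih x hx)).const_smul (v n)⁻¹
      · filter_upwards [hderiv k] with a ha
        exact (ha x hx).tendsto_slope_zero.comp hv.1
  intro x hx
  obtain ⟨t₀, ht₀, b₀, hb₀, hle₀⟩ := hbound k x hx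
  obtain ⟨t₁, ht₁, b₁, hb₁, hle₁⟩ := hbound (k + 1) x hx
  refine (hasDerivAt_integral_of_dominated_loc_of_deriv_le (F := g k) (F' := g (k + 1))
    (s := t₁ ∩ s) (bound := b₁) (inter_mem ht₁ (hs.mem_nhds hx)) ?_ ?_ (hm (k + 1) x hx) ?_ hb₁ ?_).2
  · filter_upwards [hs.mem_nhds hx] with y hy using hm k y hy
  · exact hb₀.mono' (hm k x hx) (hle₀.mono fun a ha => ha x (mem_of_mem_nhds ht₀))
  · exact hle₁.mono fun a ha y hy => ha y hy.1
  · exact (hderiv k).mono fun a ha y hy => ha y hy.2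

end DerivativeChain

/-- If the derivatives of a positive function grow like `T ^ j` relative to the function, then so do
those of its reciprocal, with constants independent of the function. -/
lemma exists_abs_iteratedDeriv_inv_le (B : ℕ → ℝ) (k : ℕ) :
    ∃ C : ℝ, 0 ≤ C ∧ ∀ (m : ℝ → ℝ) (x T : ℝ), 0 ≤ T → 0 < m x → (∀ n : ℕ, ContDiffAt ℝ n m x) →
      (∀ j, |iteratedDeriv j m x| ≤ B j * T ^ j * m x) →
      |iteratedDeriv k (fun y => (m y)⁻¹) x| ≤ C * T ^ k * (m x)⁻¹ := by
  induction k using Nat.strong_induction_on with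
  | _ k ih =>
  rcases Nat.eq_zero_or_pos k with rfl | hk
  · refine ⟨1, zero_le_one, fun m x T _ hm _ _ => ?_⟩
    simp [abs_of_pos hm]
  choose! C hC0 hC using ih
  refine ⟨∑ i ∈ Finset.range k, k.choose i * (C i * |B (k - i)|),
    Finset.sum_nonneg fun i hi => by
      have := hC0 i (Finset.mem_range.1 hi)
      positivity, fun m x T hT hm hsm hB => ?_⟩
  have hinv : ContDiffAt ℝ k (fun y => (m y)⁻¹) x := (hsm k).inv hm.ne'
  have hone : (fun y => (m y)⁻¹ * m y) =ᶠ[𝓝 x] fun _ => 1 := by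
    filter_upwards [(hsm 0).continuousAt.eventually_ne hm.ne'] with y hy
    exact inv_mul_cancel₀ hy
  have hzero : iteratedDeriv k (fun y => (m y)⁻¹ * m y) x = 0 := by
    rw [hone.iteratedDeriv_eq, iteratedDeriv_const, if_neg hk.ne']
  rw [iteratedDeriv_fun_mul hinv (hsm k), Finset.sum_range_succ] at hzero
  simp only [Nat.choose_self, Nat.cast_one, one_mul, Nat.sub_self, iteratedDeriv_zero] at hzero
  have hle : |iteratedDeriv k (fun y => (m y)⁻¹) x| * m x
      ≤ (∑ i ∈ Finset.range k, k.choose i * (C i * |B (k - i)|)) * T ^ k := by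
    rw [← abs_of_pos hm, ← abs_mul, eq_neg_of_add_eq_zero_right hzero, abs_neg,
      Finset.sum_mul]
    refine (Finset.abs_sum_le_sum_abs _ _).trans (Finset.sum_le_sum fun i hi => ?_)
    have hik := Finset.mem_range.1 hi
    have h1 := hC i hik m x T hT hm hsm hB
    have h2 : |iteratedDeriv (k - i) m x| ≤ |B (k - i)| * T ^ (k - i) * m x :=
      (hB (k - i)).trans (by gcongr; exact le_abs_self _)
    have hpow : T ^ k = T ^ i * T ^ (k - i) := by rw [← pow_add]; congr 1; omega
    rw [abs_mul, abs_mul, Nat.abs_cast, hpow]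
    calc (k.choose i : ℝ) * |iteratedDeriv i (fun y => (m y)⁻¹) x| * |iteratedDeriv (k - i) m x|
        ≤ k.choose i * (C i * T ^ i * (m x)⁻¹) * (|B (k - i)| * T ^ (k - i) * m x) := by
          have := hC0 i hik
          gcongr
      _ = _ := by field_simp
  rw [← div_eq_mul_inv, le_div_iff₀ hm]
  exact hle

section BesselBounds

lemma one_add_sq_div_two_le_cosh {t : ℝ} (ht : 0 ≤ t) : 1 + t ^ 2 / 2 ≤ Real.cosh t := by
  have h1 : Real.cosh t = 1 + 2 * Real.sinh (t / 2) ^ 2 := by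
    have h := Real.cosh_two_mul (t / 2)
    rw [mul_div_cancel₀ t two_ne_zero, Real.cosh_sq] at h
    linarith
  have h2 : t / 2 ≤ Real.sinh (t / 2) := Real.self_le_sinh_iff.2 (by positivity)
  have h3 : (t / 2) ^ 2 ≤ Real.sinh (t / 2) ^ 2 := by gcongr
  rw [h1]
  linarith

lemma mul_exp_half_div_two_le_sinh {t : ℝ} (ht : 0 ≤ t) :
    t * Real.exp (t / 2) / 2 ≤ Real.sinh t := by
  have h1 : Real.sinh t = 2 * Real.sinh (t / 2) * Real.cosh (t / 2) := by
    rw [← Real.sinh_two_mul, mul_div_cancel₀ t two_ne_zero]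
  have h2 : t / 2 ≤ Real.sinh (t / 2) := Real.self_le_sinh_iff.2 (by positivity)
  have h3 : Real.exp (t / 2) / 2 ≤ Real.cosh (t / 2) := by
    rw [Real.cosh_eq]
    linarith [Real.exp_pos (-(t / 2))]
  rw [h1]
  calc t * Real.exp (t / 2) / 2 = 2 * (t / 2) * (Real.exp (t / 2) / 2) := by ring
    _ ≤ _ := by gcongr

lemma K0_integrand_le {x t : ℝ} (hx : 0 ≤ x) (ht : 0 ≤ t) :
    Real.exp (-x * Real.cosh t) ≤ Real.exp (-x) * Real.exp (-(x / 2) * t ^ 2) := by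
  rw [← Real.exp_add, Real.exp_le_exp]
  nlinarith [mul_le_mul_of_nonneg_left (one_add_sq_div_two_le_cosh ht) hx]

lemma integrableOn_K0_integrand {x : ℝ} (hx : 0 < x) :
    IntegrableOn (fun t => Real.exp (-x * Real.cosh t)) (Ioi 0) := by
  refine Integrable.mono' (((integrable_exp_neg_mul_sq (half_pos hx)).const_mul
    (Real.exp (-x))).integrableOn) (by fun_prop) ?_
  filter_upwards [ae_restrict_mem measurableSet_Ioi] with t ht
  rw [Real.norm_of_nonneg (Real.exp_pos _).le]
  exact K0_integrand_le hx.le (le_of_lt ht)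

lemma K0_nonneg (x : ℝ) : 0 ≤ K0 x := integral_nonneg fun _ => (Real.exp_pos _).le

lemma K0_pos {x : ℝ} (hx : 0 < x) : 0 < K0 x := by
  rw [K0, setIntegral_pos_iff_support_of_nonneg_ae
    (Eventually.of_forall fun _ => (Real.exp_pos _).le) (integrableOn_K0_integrand hx)]
  have : Function.support (fun t => Real.exp (-x * Real.cosh t)) = Set.univ := by
    ext t
    simp [Real.exp_ne_zero]
  rw [this]
  simp

lemma K0_antitoneOn : AntitoneOn K0 (Ioi 0) := by
  intro x hx y hy hxy
  refine setIntegral_mono_on (integrableOn_K0_integrand hy) (integrableOn_K0_integrand hx)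
    measurableSet_Ioi fun t _ => ?_
  rw [Real.exp_le_exp]
  nlinarith [Real.one_le_cosh t]

lemma K0_le {x : ℝ} (hx : 0 < x) : K0 x ≤ Real.exp (-x) * (√(π / (x / 2)) / 2) := by
  rw [← integral_gaussian_Ioi, ← MeasureTheory.integral_const_mul, K0]
  exact setIntegral_mono_on (integrableOn_K0_integrand hx)
    ((integrable_exp_neg_mul_sq (half_pos hx)).const_mul _).integrableOn
    measurableSet_Ioi fun t ht => K0_integrand_le hx.le (le_of_lt ht)

lemma K0_le_exp_neg {x : ℝ} (hx : 2 ≤ x) : K0 x ≤ Real.exp (-x) := by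
  refine (K0_le (by linarith)).trans (mul_le_of_le_one_right (Real.exp_pos _).le ?_)
  rw [div_le_one two_pos, Real.sqrt_le_left two_pos.le, div_le_iff₀ (by linarith)]
  linarith [Real.pi_le_four]

lemma K0_le_rpow {x : ℝ} (hx : 0 < x) : K0 x ≤ √(2 * π) * x ^ (-(1 / 2) : ℝ) := by
  refine (K0_le hx).trans ((mul_le_of_le_one_left (by positivity)
    (Real.exp_le_one_iff.2 (by linarith))).trans ?_)
  have : √(π / (x / 2)) = √(2 * π) * x ^ (-(1 / 2) : ℝ) := by
    rw [Real.rpow_neg hx.le, ← Real.sqrt_eq_rpow, ← Real.sqrt_inv, ← Real.sqrt_mul (by positivity)]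
    congr 1
    field_simp
  rw [this]
  exact half_le_self (by positivity)

lemma measurable_K0 : Measurable K0 := by
  have : StronglyMeasurable (Function.uncurry fun x t : ℝ => Real.exp (-x * Real.cosh t)) := by
    refine Continuous.stronglyMeasurable ?_
    simp only [Function.uncurry_def]
    fun_prop
  exact (this.integral_prod_right (ν := volume.restrict (Ioi 0))).measurable

/-- The `j`-th derivative in `ν` of the integrand in Nicholson's formula. -/
noncomputable def nicholsonDeriv (u : ℝ) (j : ℕ) (ν t : ℝ) : ℝ :=
  K0 (2 * u * Real.sinh t) *
    ((2 * t) ^ j * ((Real.exp (2 * ν * t) + (-1) ^ j * Real.exp (-(2 * ν * t))) / 2))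

lemma nicholsonDeriv_zero (u ν t : ℝ) :
    nicholsonDeriv u 0 ν t = K0 (2 * u * Real.sinh t) * Real.cosh (2 * ν * t) := by
  simp [nicholsonDeriv, Real.cosh_eq]

lemma hasDerivAt_nicholsonDeriv (u : ℝ) (j : ℕ) (ν t : ℝ) :
    HasDerivAt (fun y => nicholsonDeriv u j y t) (nicholsonDeriv u (j + 1) ν t) ν := by
  have h : HasDerivAt (fun y : ℝ => 2 * y * t) (2 * t) ν := by
    simpa using ((hasDerivAt_id ν).const_mul 2).mul_const t
  have := (((h.exp.add ((h.neg.exp).const_mul ((-1) ^ j))).div_const 2).const_mul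
    ((2 * t) ^ j)).const_mul (K0 (2 * u * Real.sinh t))
  refine this.congr_deriv ?_
  simp only [nicholsonDeriv, Pi.neg_apply]
  ring

lemma measurable_nicholsonDeriv (u : ℝ) (j : ℕ) (ν : ℝ) : Measurable (nicholsonDeriv u j ν) := by
  unfold nicholsonDeriv
  refine (measurable_K0.comp (by fun_prop)).mul (by fun_prop)

lemma abs_nicholsonDeriv_le (u : ℝ) (j : ℕ) {ν t : ℝ} (ht : 0 ≤ t) :
    |nicholsonDeriv u j ν t| ≤ K0 (2 * u * Real.sinh t) * ((2 * t) ^ j * Real.cosh (2 * ν * t)) := by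
  rw [nicholsonDeriv, abs_mul, abs_mul, abs_of_nonneg (K0_nonneg _),
    abs_of_nonneg (show 0 ≤ (2 * t) ^ j by positivity), Real.cosh_eq, abs_div, abs_two]
  have : |Real.exp (2 * ν * t) + (-1) ^ j * Real.exp (-(2 * ν * t))|
      ≤ Real.exp (2 * ν * t) + Real.exp (-(2 * ν * t)) := by
    refine (abs_add_le _ _).trans (le_of_eq ?_)
    simp [abs_mul]
  have := K0_nonneg (2 * u * Real.sinh t)
  gcongr

/-- The effective cutoff in Nicholson's integral. -/
noncomputable def nicholsonCutoff (ν u : ℝ) : ℝ := 2 * Real.log (2 * (ν + 1) / u)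

lemma one_le_nicholsonCutoff {ν u : ℝ} (hν : 0 ≤ ν) (hu : 0 < u) (hu1 : u ≤ 1) :
    1 ≤ nicholsonCutoff ν u := by
  have h : 2 ≤ 2 * (ν + 1) / u := by
    rw [le_div_iff₀ hu]
    nlinarith
  have := Real.log_le_log two_pos h
  have := Real.log_two_gt_d9
  rw [nicholsonCutoff]
  linarith

lemma exp_nicholsonCutoff {ν u : ℝ} (hν : 0 ≤ ν) (hu : 0 < u) :
    Real.exp (nicholsonCutoff ν u) = (2 * (ν + 1)) ^ 2 * Real.exp (-2 * Real.log u) := by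
  have h : 0 < 2 * (ν + 1) := by positivity
  rw [nicholsonCutoff, Real.log_div h.ne' hu.ne', ← Real.exp_log (pow_pos h 2), ← Real.exp_add,
    Real.log_pow]
  congr 1
  push_cast
  ring

lemma K0_mul_le_exp_neg {ν u t : ℝ} (j : ℕ) (hν : 0 ≤ ν) (hu : 0 < u) (hu1 : u ≤ 1)
    (ht : nicholsonCutoff ν u < t) :
    K0 (2 * u * Real.sinh t) * ((2 * t) ^ j * Real.cosh (2 * ν * t))
      ≤ 2 ^ j * j.factorial * Real.exp (-t) := by
  have hT := one_le_nicholsonCutoff hν hu hu1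
  have ht0 : 0 < t := by linarith
  have hs : 2 * (ν + 1) * t ≤ 2 * u * Real.sinh t := by
    have h1 : 2 * (ν + 1) / u ≤ Real.exp (t / 2) := by
      rw [← Real.log_le_iff_le_exp (by positivity)]
      rw [nicholsonCutoff] at ht
      linarith
    have h2 := mul_exp_half_div_two_le_sinh ht0.le
    calc 2 * (ν + 1) * t = 2 * u * (t * (2 * (ν + 1) / u) / 2) := by field_simp
      _ ≤ 2 * u * (t * Real.exp (t / 2) / 2) := by gcongr
      _ ≤ _ := by gcongr
  have hx : 2 ≤ 2 * u * Real.sinh t := by nlinarith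
  have hK : K0 (2 * u * Real.sinh t) ≤ Real.exp (-(2 * (ν + 1) * t)) :=
    (K0_le_exp_neg hx).trans (Real.exp_le_exp.2 (neg_le_neg hs))
  have hc : Real.cosh (2 * ν * t) ≤ Real.exp (2 * ν * t) := by
    rw [Real.cosh_eq]
    have : Real.exp (-(2 * ν * t)) ≤ Real.exp (2 * ν * t) := by
      rw [Real.exp_le_exp]
      have : 0 ≤ 2 * ν * t := by positivity
      linarith
    linarith
  have hp : t ^ j ≤ j.factorial * Real.exp t := by
    have := Real.pow_div_factorial_le_exp t ht0.le j
    rwa [div_le_iff₀ (by positivity), mul_comm] at this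
  calc K0 (2 * u * Real.sinh t) * ((2 * t) ^ j * Real.cosh (2 * ν * t))
      ≤ Real.exp (-(2 * (ν + 1) * t)) *
        ((2 ^ j * (j.factorial * Real.exp t)) * Real.exp (2 * ν * t)) := by
        rw [mul_pow]
        have := Real.cosh_pos (2 * ν * t)
        gcongr
    _ = 2 ^ j * j.factorial * Real.exp (-(2 * (ν + 1) * t) + t + 2 * ν * t) := by
        rw [Real.exp_add, Real.exp_add]
        ring
    _ = _ := by
        congr 2
        ring

lemma K0_mul_le {ν u t : ℝ} (j : ℕ) (hν : 0 ≤ ν) (hu : 0 < u) (hu1 : u ≤ 1) (ht : 0 < t) :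
    K0 (2 * u * Real.sinh t) * ((2 * t) ^ j * Real.cosh (2 * ν * t))
      ≤ (2 * nicholsonCutoff ν u) ^ j * nicholsonDeriv u 0 ν t
        + 2 ^ j * j.factorial * Real.exp (-t) := by
  have hT := one_le_nicholsonCutoff hν hu hu1
  have hK := K0_nonneg (2 * u * Real.sinh t)
  have hc := Real.cosh_pos (2 * ν * t)
  rw [nicholsonDeriv_zero]
  rcases le_or_gt t (nicholsonCutoff ν u) with h | h
  · refine le_add_of_le_of_nonneg ?_ (by positivity)
    calc _ ≤ K0 (2 * u * Real.sinh t) * ((2 * nicholsonCutoff ν u) ^ j * Real.cosh (2 * ν * t)) := by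
          gcongr
      _ = _ := by ring
  · exact le_add_of_nonneg_of_le (by positivity) (K0_mul_le_exp_neg j hν hu hu1 h)

lemma integrableOn_nicholsonDeriv_zero {ν u : ℝ} (hν : 0 ≤ ν) (hu : 0 < u) (hu1 : u ≤ 1) :
    IntegrableOn (nicholsonDeriv u 0 ν) (Ioi 0) := by
  set T := nicholsonCutoff ν u with hT
  have hT1 : 1 ≤ T := one_le_nicholsonCutoff hν hu hu1
  rw [← Ioc_union_Ioi_eq_Ioi (zero_le_one.trans hT1)]
  refine IntegrableOn.union ?_ ?_
  · have hi : IntegrableOn (fun t : ℝ => √(2 * π) * (2 * u) ^ (-(1 / 2) : ℝ) *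
        Real.cosh (2 * ν * T) * t ^ (-(1 / 2) : ℝ)) (Ioc 0 T) := by
      refine Integrable.const_mul ?_ _
      exact (intervalIntegrable_iff_integrableOn_Ioc_of_le (zero_le_one.trans hT1)).1
        (intervalIntegral.intervalIntegrable_rpow' (by norm_num))
    refine hi.mono' (measurable_nicholsonDeriv u 0 ν).aestronglyMeasurable ?_
    filter_upwards [ae_restrict_mem measurableSet_Ioc] with t ht
    have ht0 : 0 < t := ht.1
    have hs : t ≤ Real.sinh t := Real.self_le_sinh_iff.2 ht0.le
    have hK : K0 (2 * u * Real.sinh t) ≤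
        √(2 * π) * ((2 * u) ^ (-(1 / 2) : ℝ) * t ^ (-(1 / 2) : ℝ)) := by
      rw [← Real.mul_rpow (by positivity) ht0.le]
      refine (K0_antitoneOn (show 0 < 2 * u * t by positivity)
        (show 0 < 2 * u * Real.sinh t by nlinarith) (by gcongr)).trans (K0_le_rpow (by positivity))
    have hc : Real.cosh (2 * ν * t) ≤ Real.cosh (2 * ν * T) := by
      rw [Real.cosh_le_cosh, abs_of_nonneg (by positivity), abs_of_nonneg (by positivity)]
      have := ht.2
      gcongr
    have hK0 := K0_nonneg (2 * u * Real.sinh t)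
    have hc0 := Real.cosh_pos (2 * ν * t)
    rw [nicholsonDeriv_zero, Real.norm_of_nonneg (by positivity)]
    calc _ ≤ √(2 * π) * ((2 * u) ^ (-(1 / 2) : ℝ) * t ^ (-(1 / 2) : ℝ)) * Real.cosh (2 * ν * T) := by
          gcongr
      _ = _ := by ring
  · have hi : IntegrableOn (fun t : ℝ => Real.exp (-t)) (Ioi T) := integrableOn_exp_neg_Ioi T
    refine hi.mono' (measurable_nicholsonDeriv u 0 ν).aestronglyMeasurable ?_
    filter_upwards [ae_restrict_mem measurableSet_Ioi] with t ht
    have ht' : T < t := ht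
    have ht0 : 0 ≤ t := by linarith
    refine (abs_nicholsonDeriv_le u 0 ht0).trans ?_
    simpa using K0_mul_le_exp_neg 0 hν hu hu1 ht

/-- An integrable bound for `nicholsonDeriv u j y` uniform in `|y| ≤ ν`. -/
noncomputable def nicholsonBound (u : ℝ) (j : ℕ) (ν t : ℝ) : ℝ :=
  (2 * nicholsonCutoff ν u) ^ j * nicholsonDeriv u 0 ν t + 2 ^ j * j.factorial * Real.exp (-t)

lemma integrableOn_nicholsonBound {ν u : ℝ} (j : ℕ) (hν : 0 ≤ ν) (hu : 0 < u) (hu1 : u ≤ 1) :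
    IntegrableOn (nicholsonBound u j ν) (Ioi 0) :=
  ((integrableOn_nicholsonDeriv_zero hν hu hu1).const_mul _).add
    ((integrableOn_exp_neg_Ioi 0).const_mul _)

lemma abs_nicholsonDeriv_le_nicholsonBound {ν y u t : ℝ} (j : ℕ) (hy : |y| ≤ ν)
    (hu : 0 < u) (hu1 : u ≤ 1) (ht : 0 < t) :
    |nicholsonDeriv u j y t| ≤ nicholsonBound u j ν t := by
  have hν : 0 ≤ ν := (abs_nonneg y).trans hy
  refine (abs_nicholsonDeriv_le u j ht.le).trans (le_trans ?_ (K0_mul_le j hν hu hu1 ht))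
  have hK := K0_nonneg (2 * u * Real.sinh t)
  have hc : Real.cosh (2 * y * t) ≤ Real.cosh (2 * ν * t) := by
    rw [Real.cosh_le_cosh, abs_mul, abs_mul, abs_mul, abs_mul, abs_of_nonneg hν]
    gcongr
  gcongr

lemma hasDerivAt_integral_nicholsonDeriv {u : ℝ} (hu : 0 < u) (hu1 : u ≤ 1) (j : ℕ) (ν : ℝ) :
    HasDerivAt (fun y => ∫ t in Ioi (0 : ℝ), nicholsonDeriv u j y t)
      (∫ t in Ioi (0 : ℝ), nicholsonDeriv u (j + 1) ν t) ν := by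
  refine hasDerivAt_integral_of_forall_hasDerivAt (g := nicholsonDeriv u) (s := Set.univ) isOpen_univ
    (fun x _ => (measurable_nicholsonDeriv u 0 x).aestronglyMeasurable)
    (fun k => Eventually.of_forall fun t x _ => hasDerivAt_nicholsonDeriv u k x t)
    (fun k x _ => ⟨Metric.ball x 1, Metric.ball_mem_nhds x one_pos,
      nicholsonBound u k (|x| + 1), integrableOn_nicholsonBound k (by positivity) hu hu1, ?_⟩)
    j ν (Set.mem_univ ν)
  filter_upwards [ae_restrict_mem measurableSet_Ioi] with t ht y hy
  refine abs_nicholsonDeriv_le_nicholsonBound k ?_ hu hu1 ht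
  rw [Metric.mem_ball, Real.dist_eq] at hy
  have := abs_sub_abs_le_abs_sub y x
  linarith

end BesselBounds

section PhaseIntegrand

lemma exp_le_integral_nicholsonDeriv_zero {ν u : ℝ} (hν : 0 ≤ ν) (hu : 0 < u) (hu1 : u ≤ 1) :
    K0 (Real.exp 2) / 2 * Real.exp (2 * ν * (1 - Real.log u))
      ≤ ∫ t in Ioi (0 : ℝ), nicholsonDeriv u 0 ν t := by
  have hlog : Real.log u ≤ 0 := Real.log_nonpos hu.le hu1
  have hint := integrableOn_nicholsonDeriv_zero hν hu hu1
  have hsub : Ioc (1 - Real.log u) (2 - Real.log u) ⊆ Ioi 0 := fun t ht => by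
    have := ht.1
    rw [mem_Ioi]
    linarith
  have hnonneg : ∀ t, 0 ≤ nicholsonDeriv u 0 ν t := fun t => by
    rw [nicholsonDeriv_zero]
    exact mul_nonneg (K0_nonneg _) (Real.cosh_pos _).le
  have hle : ∀ t ∈ Ioc (1 - Real.log u) (2 - Real.log u),
      K0 (Real.exp 2) / 2 * Real.exp (2 * ν * (1 - Real.log u)) ≤ nicholsonDeriv u 0 ν t := by
    intro t ht
    have ht0 : 0 < t := hsub ht
    have hs0 : 0 < Real.sinh t := Real.sinh_pos_iff.2 ht0
    have hs : 2 * u * Real.sinh t ≤ Real.exp 2 := by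
      have h1 : Real.sinh t ≤ Real.exp t / 2 := by
        rw [Real.sinh_eq]
        linarith [Real.exp_pos (-t)]
      calc 2 * u * Real.sinh t ≤ 2 * u * (Real.exp t / 2) := by gcongr
        _ = Real.exp (Real.log u) * Real.exp t := by rw [Real.exp_log hu]; ring
        _ = Real.exp (Real.log u + t) := (Real.exp_add _ _).symm
        _ ≤ _ := Real.exp_le_exp.2 (by linarith [ht.2])
    have hK : K0 (Real.exp 2) ≤ K0 (2 * u * Real.sinh t) :=
      K0_antitoneOn (show 0 < 2 * u * Real.sinh t by positivity) (Real.exp_pos 2) hs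
    have hc : Real.exp (2 * ν * (1 - Real.log u)) / 2 ≤ Real.cosh (2 * ν * t) := by
      have h1 : Real.exp (2 * ν * (1 - Real.log u)) ≤ Real.exp (2 * ν * t) := by
        rw [Real.exp_le_exp]
        have := ht.1
        gcongr
      rw [Real.cosh_eq]
      linarith [Real.exp_pos (-(2 * ν * t))]
    rw [nicholsonDeriv_zero]
    calc _ = K0 (Real.exp 2) * (Real.exp (2 * ν * (1 - Real.log u)) / 2) := by ring
      _ ≤ _ := by
        have := K0_nonneg (2 * u * Real.sinh t)
        gcongr
  calc _ = ∫ _ in Ioc (1 - Real.log u) (2 - Real.log u),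
        K0 (Real.exp 2) / 2 * Real.exp (2 * ν * (1 - Real.log u)) := by
        rw [setIntegral_const, Real.volume_real_Ioc_of_le (by linarith), smul_eq_mul]
        ring
    _ ≤ ∫ t in Ioc (1 - Real.log u) (2 - Real.log u), nicholsonDeriv u 0 ν t :=
        setIntegral_mono_on (integrableOn_const (by simp)) (hint.mono_set hsub) measurableSet_Ioc hle
    _ ≤ _ := setIntegral_mono_set hint (Eventually.of_forall hnonneg) hsub.eventuallyLE

lemma abs_integral_nicholsonDeriv_le {ν u : ℝ} (j : ℕ) (hν : 0 ≤ ν) (hu : 0 < u) (hu1 : u ≤ 1) :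
    |∫ t in Ioi (0 : ℝ), nicholsonDeriv u j ν t|
      ≤ (2 ^ j + 2 ^ j * j.factorial / (K0 (Real.exp 2) / 2)) * nicholsonCutoff ν u ^ j
        * ∫ t in Ioi (0 : ℝ), nicholsonDeriv u 0 ν t := by
  set T := nicholsonCutoff ν u with hT
  set I := ∫ t in Ioi (0 : ℝ), nicholsonDeriv u 0 ν t with hI
  set c := K0 (Real.exp 2) / 2 with hc
  have hc0 : 0 < c := half_pos (K0_pos (Real.exp_pos 2))
  have hT1 : 1 ≤ T ^ j := one_le_pow₀ (one_le_nicholsonCutoff hν hu hu1)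
  have hIc : c ≤ I := by
    refine le_trans ?_ (exp_le_integral_nicholsonDeriv_zero hν hu hu1)
    refine le_mul_of_one_le_right hc0.le (Real.one_le_exp ?_)
    have := Real.log_nonpos hu.le hu1
    exact mul_nonneg (by positivity) (by linarith)
  have h1 : |∫ t in Ioi (0 : ℝ), nicholsonDeriv u j ν t|
      ≤ ∫ t in Ioi (0 : ℝ), nicholsonBound u j ν t := by
    refine MeasureTheory.norm_integral_le_of_norm_le (f := nicholsonDeriv u j ν) (integrableOn_nicholsonBound j hν hu hu1) ?_
    filter_upwards [ae_restrict_mem measurableSet_Ioi] with t ht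
    exact abs_nicholsonDeriv_le_nicholsonBound j (abs_of_nonneg hν).le hu hu1 ht
  have h2 : ∫ t in Ioi (0 : ℝ), nicholsonBound u j ν t = (2 * T) ^ j * I + 2 ^ j * j.factorial := by
    unfold nicholsonBound
    rw [integral_add ((integrableOn_nicholsonDeriv_zero hν hu hu1).const_mul _)
      ((integrableOn_exp_neg_Ioi 0).const_mul _), MeasureTheory.integral_const_mul,
      MeasureTheory.integral_const_mul, integral_exp_neg_Ioi_zero, mul_one]
  have h3 : 1 ≤ T ^ j * I / c := by
    rw [le_div_iff₀ hc0]
    nlinarith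
  have h4 : (2 : ℝ) ^ j * j.factorial ≤ 2 ^ j * j.factorial * (T ^ j * I / c) :=
    le_mul_of_one_le_right (by positivity) h3
  calc _ ≤ (2 * T) ^ j * I + 2 ^ j * j.factorial := h1.trans h2.le
    _ ≤ (2 * T) ^ j * I + 2 ^ j * j.factorial * (T ^ j * I / c) := by gcongr
    _ = _ := by rw [mul_pow]; ring

lemma M2_eq (ν u : ℝ) :
    M2 ν u = 8 / π ^ 2 * ∫ t in Ioi (0 : ℝ), nicholsonDeriv u 0 ν t := by
  simp only [M2, nicholsonDeriv_zero]

lemma hasDerivAt_scaled_integral_nicholsonDeriv {u : ℝ} (hu : 0 < u) (hu1 : u ≤ 1) (j : ℕ) (ν : ℝ) :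
    HasDerivAt (fun y => u * (8 / π ^ 2 * ∫ t in Ioi (0 : ℝ), nicholsonDeriv u j y t))
      (u * (8 / π ^ 2 * ∫ t in Ioi (0 : ℝ), nicholsonDeriv u (j + 1) ν t)) ν :=
  ((hasDerivAt_integral_nicholsonDeriv hu hu1 j ν).const_mul _).const_mul _

lemma contDiffAt_mul_M2 {u : ℝ} (hu : 0 < u) (hu1 : u ≤ 1) (n : ℕ) (ν : ℝ) :
    ContDiffAt ℝ n (fun y => u * M2 y u) ν := by
  simp only [M2_eq]
  exact contDiffAt_of_forall_hasDerivAt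
    (G := fun j y => u * (8 / π ^ 2 * ∫ t in Ioi (0 : ℝ), nicholsonDeriv u j y t)) isOpen_univ
    (fun j y _ => hasDerivAt_scaled_integral_nicholsonDeriv hu hu1 j y) n (Set.mem_univ ν)

lemma iteratedDeriv_mul_M2 {u : ℝ} (hu : 0 < u) (hu1 : u ≤ 1) (j : ℕ) (ν : ℝ) :
    iteratedDeriv j (fun y => u * M2 y u) ν
      = u * (8 / π ^ 2 * ∫ t in Ioi (0 : ℝ), nicholsonDeriv u j ν t) := by
  simp only [M2_eq]
  exact iteratedDeriv_eq_of_forall_hasDerivAt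
    (G := fun j y => u * (8 / π ^ 2 * ∫ t in Ioi (0 : ℝ), nicholsonDeriv u j y t)) isOpen_univ
    (fun j y _ => hasDerivAt_scaled_integral_nicholsonDeriv hu hu1 j y) j ν (Set.mem_univ ν)

lemma exp_le_M2 {ν u : ℝ} (hν : 0 ≤ ν) (hu : 0 < u) (hu1 : u ≤ 1) :
    8 / π ^ 2 * (K0 (Real.exp 2) / 2 * Real.exp (2 * ν * (1 - Real.log u))) ≤ M2 ν u := by
  rw [M2_eq]
  have := exp_le_integral_nicholsonDeriv_zero hν hu hu1
  gcongr

lemma M2_pos {ν u : ℝ} (hν : 0 ≤ ν) (hu : 0 < u) (hu1 : u ≤ 1) : 0 < M2 ν u := by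
  have := K0_pos (Real.exp_pos 2)
  exact lt_of_lt_of_le (by positivity) (exp_le_M2 hν hu hu1)

lemma contDiffAt_one_div_mul_M2 {ν u : ℝ} (hν : 0 ≤ ν) (hu : 0 < u) (hu1 : u ≤ 1) (n : ℕ) :
    ContDiffAt ℝ n (fun y => 1 / (u * M2 y u)) ν := by
  simp only [one_div]
  exact (contDiffAt_mul_M2 hu hu1 n ν).inv (mul_pos hu (M2_pos hν hu hu1)).ne'

lemma exists_abs_iteratedDeriv_one_div_mul_M2_le (k : ℕ) :
    ∃ C : ℝ, 0 ≤ C ∧ ∀ ν u : ℝ, 3 / 2 ≤ ν → 0 < u → u ≤ 1 →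
      |iteratedDeriv k (fun y => 1 / (u * M2 y u)) ν| ≤ C * ((ν + 1) ^ 2 * Real.exp (-2 * ν)) := by
  obtain ⟨C, hC0, hC⟩ := exists_abs_iteratedDeriv_inv_le
    (fun j => 2 ^ j + 2 ^ j * j.factorial / (K0 (Real.exp 2) / 2)) k
  have hK := K0_pos (Real.exp_pos 2)
  set c := 8 / π ^ 2 * (K0 (Real.exp 2) / 2) with hc
  have hc0 : 0 < c := by positivity
  refine ⟨C * k.factorial * 4 / c, by positivity, fun ν u hν hu hu1 => ?_⟩
  have hν0 : 0 ≤ ν := by linarith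
  have hlog : Real.log u ≤ 0 := Real.log_nonpos hu.le hu1
  have hT := one_le_nicholsonCutoff hν0 hu hu1
  have hM := M2_pos hν0 hu hu1
  have h1 := hC (fun y => u * M2 y u) ν (nicholsonCutoff ν u) (by linarith) (mul_pos hu hM)
    (fun n => contDiffAt_mul_M2 hu hu1 n ν) (fun j => by
      rw [iteratedDeriv_mul_M2 hu hu1, abs_mul, abs_mul, abs_of_pos hu,
        abs_of_pos (show 0 < 8 / π ^ 2 by positivity), M2_eq]
      have := abs_integral_nicholsonDeriv_le j hν0 hu hu1
      refine (mul_le_mul_of_nonneg_left (mul_le_mul_of_nonneg_left this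
        (show 0 ≤ 8 / π ^ 2 by positivity)) hu.le).trans (le_of_eq ?_)
      ring)
  simp only [one_div]
  refine h1.trans ?_
  have h2 : nicholsonCutoff ν u ^ k ≤
      k.factorial * ((2 * (ν + 1)) ^ 2 * Real.exp (-2 * Real.log u)) := by
    rw [← exp_nicholsonCutoff hν0 hu, ← div_le_iff₀' (by positivity)]
    exact Real.pow_div_factorial_le_exp _ (by linarith) k
  have h3 : (u * M2 ν u)⁻¹ ≤ c⁻¹ * Real.exp (-2 * ν + (2 * ν - 1) * Real.log u) := by
    have h4 : c * Real.exp (2 * ν + (1 - 2 * ν) * Real.log u) ≤ u * M2 ν u := by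
      calc _ = Real.exp (Real.log u) * (c * Real.exp (2 * ν * (1 - Real.log u))) := by
            rw [mul_left_comm, ← Real.exp_add]
            congr 2
            ring
        _ = u * (8 / π ^ 2 * (K0 (Real.exp 2) / 2 * Real.exp (2 * ν * (1 - Real.log u)))) := by
            rw [Real.exp_log hu, hc]
            ring
        _ ≤ _ := by
            have := exp_le_M2 hν0 hu hu1
            gcongr
    refine (inv_anti₀ (by positivity) h4).trans (le_of_eq ?_)
    rw [mul_inv, ← Real.exp_neg]
    congr 2
    ring
  calc _ ≤ C * (k.factorial * ((2 * (ν + 1)) ^ 2 * Real.exp (-2 * Real.log u))) *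
        (c⁻¹ * Real.exp (-2 * ν + (2 * ν - 1) * Real.log u)) := by
        have := mul_pos hu hM
        gcongr
    _ = C * k.factorial * 4 / c * ((ν + 1) ^ 2 *
        Real.exp (-2 * Real.log u + (-2 * ν + (2 * ν - 1) * Real.log u))) := by
        rw [Real.exp_add (-2 * Real.log u)]
        ring
    _ ≤ _ := by
        gcongr
        nlinarith

lemma measurable_M2 (ν : ℝ) : Measurable (M2 ν) := by
  have : StronglyMeasurable (Function.uncurry fun u t : ℝ =>
      K0 (2 * u * Real.sinh t) * Real.cosh (2 * ν * t)) := by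
    simp only [Function.uncurry_def]
    exact ((measurable_K0.comp (by fun_prop)).mul (by fun_prop)).stronglyMeasurable
  exact ((this.integral_prod_right (ν := volume.restrict (Ioi 0))).measurable).const_mul _

lemma hasDerivAt_integral_iteratedDeriv_one_div_mul_M2 (k : ℕ) :
    ∀ ν ∈ Ioi (3 / 2 : ℝ),
      HasDerivAt (fun y => ∫ u in Ioc (0 : ℝ) 1, iteratedDeriv k (fun y' => 1 / (u * M2 y' u)) y)
        (∫ u in Ioc (0 : ℝ) 1, iteratedDeriv (k + 1) (fun y' => 1 / (u * M2 y' u)) ν) ν := by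
  refine hasDerivAt_integral_of_forall_hasDerivAt
    (g := fun k ν u => iteratedDeriv k (fun y' => 1 / (u * M2 y' u)) ν) isOpen_Ioi ?_ ?_ ?_ k
  · intro ν _
    simp only [iteratedDeriv_zero]
    exact ((measurable_id.mul (measurable_M2 ν)).const_div 1).aestronglyMeasurable
  · intro j
    filter_upwards [ae_restrict_mem measurableSet_Ioc] with u hu ν hν
    exact hasDerivAt_iteratedDeriv
      (contDiffAt_one_div_mul_M2 (le_trans (by norm_num) (le_of_lt hν)) hu.1 hu.2 _)
  · intro j ν hν
    obtain ⟨C, hC0, hC⟩ := exists_abs_iteratedDeriv_one_div_mul_M2_le j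
    refine ⟨Ioo (3 / 2) (ν + 1), Ioo_mem_nhds hν (lt_add_one ν),
      fun _ => C * ((ν + 2) ^ 2 * 1), integrableOn_const (by simp), ?_⟩
    filter_upwards [ae_restrict_mem measurableSet_Ioc] with u hu y hy
    refine (hC y u hy.1.le hu.1 hu.2).trans ?_
    have h1 := hy.1
    have h2 := hy.2
    have h3 : Real.exp (-2 * y) ≤ 1 := Real.exp_le_one_iff.2 (by linarith)
    have h4 : (y + 1) ^ 2 ≤ (ν + 2) ^ 2 := by
      have : 0 ≤ y + 1 := by linarith
      exact pow_le_pow_left₀ this (by linarith) 2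
    gcongr

lemma sq_mul_exp_neg_two_mul_le (N : ℕ) {ν : ℝ} (hν : 1 ≤ ν) :
    (ν + 1) ^ 2 * Real.exp (-2 * ν) ≤ 4 * (N + 2).factorial / ν ^ N := by
  have hν0 : 0 < ν := by linarith
  have h1 : ν ^ (N + 2) ≤ (N + 2).factorial * Real.exp (2 * ν) := by
    rw [← div_le_iff₀' (by positivity)]
    exact (Real.pow_div_factorial_le_exp ν hν0.le (N + 2)).trans (Real.exp_le_exp.2 (by linarith))
  rw [le_div_iff₀ (by positivity), show -2 * ν = -(2 * ν) by ring, Real.exp_neg, ← div_eq_mul_inv,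
    div_mul_eq_mul_div, div_le_iff₀ (Real.exp_pos _)]
  calc (ν + 1) ^ 2 * ν ^ N ≤ (2 * ν) ^ 2 * ν ^ N := by
        gcongr
        linarith
    _ = 4 * ν ^ (N + 2) := by ring
    _ ≤ _ := by linarith

end PhaseIntegrand

/-- For every `k` and `N` there is `C > 0` such that for all `ν ≥ 2`,
`ν ↦ ∫_0^1 du/(u·M²(ν,u))` is `k` times differentiable and its `k`-th derivative
is bounded by `C·ν^{−N}`. -/
theorem small_u_phase_integral_decays (k N : ℕ) :
    ∃ C : ℝ, 0 < C ∧ ∀ ν : ℝ, 2 ≤ ν →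
      ContDiffAt ℝ k (fun ν' => ∫ u in (0:ℝ)..1, 1 / (u * M2 ν' u)) ν ∧
      |iteratedDeriv k (fun ν' => ∫ u in (0:ℝ)..1, 1 / (u * M2 ν' u)) ν| ≤ C / ν ^ N := by
  simp only [intervalIntegral.integral_of_le zero_le_one]
  have hchain := hasDerivAt_integral_iteratedDeriv_one_div_mul_M2
  obtain ⟨C, hC0, hC⟩ := exists_abs_iteratedDeriv_one_div_mul_M2_le k
  refine ⟨C * (4 * (N + 2).factorial) + 1, by positivity, fun ν hν => ?_⟩
  have hmem : ν ∈ Ioi (3 / 2 : ℝ) := lt_of_lt_of_le (by norm_num) hν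
  have hcd := contDiffAt_of_forall_hasDerivAt isOpen_Ioi hchain k hmem
  have hid := iteratedDeriv_eq_of_forall_hasDerivAt isOpen_Ioi hchain k ν hmem
  simp only [iteratedDeriv_zero] at hcd hid
  refine ⟨hcd, ?_⟩
  rw [hid]
  have h1 : |∫ u in Ioc (0 : ℝ) 1, iteratedDeriv k (fun y' => 1 / (u * M2 y' u)) ν|
      ≤ C * ((ν + 1) ^ 2 * Real.exp (-2 * ν)) := by
    have := norm_setIntegral_le_of_norm_le_const (μ := volume) (s := Ioc (0 : ℝ) 1)
      (f := fun u => iteratedDeriv k (fun y' => 1 / (u * M2 y' u)) ν) (by simp)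
      (fun u hu => hC ν u (le_of_lt hmem) hu.1 hu.2)
    simpa using this
  refine h1.trans ((mul_le_mul_of_nonneg_left
    (sq_mul_exp_neg_two_mul_le N (by linarith)) hC0).trans ?_)
  rw [← mul_div_assoc]
  gcongr
  linarith
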